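/- arXiv:2403.10678 — 2 statements merged into one kernel-verified Lean document; each statement's English description precedes it below -/
import Mathlib

section
/- For every real L ≥ 1 there exists a constant c > 0 (depending only on L) such that for every integer N ≥ 2 and every permutation π of {1, 2, …, N} satisfying |π(n) − π(m)| ≤ L·|n − m| for all n, m, there exists an affine line ℓ ⊆ ℝ² such that the number of indices n ∈ {1, …, N} with dist((n, π(n)), ℓ) ≤ 1 is at least c·log N. -/
open scoped Classical

/-- A point of the Euclidean plane with coordinates `a`, `b`. -/
noncomputable def pt (a b : ℝ) : EuclideanSpace ℝ (Fin 2) :=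
  (WithLp.equiv 2 (Fin 2 → ℝ)).symm ![a, b]

/-- `ℓ` is an affine line in the Euclidean plane. -/
def IsLine (ℓ : Set (EuclideanSpace ℝ (Fin 2))) : Prop :=
  ∃ p v : EuclideanSpace ℝ (Fin 2), v ≠ 0 ∧ ℓ = {x | ∃ t : ℝ, x = p + t • v}

/-- Intervals contained in `[u, v]` of large total length have a point of large multiplicity. -/
lemma exists_sum_length_le_mul_card {ι : Type*} (S : Finset ι) (a b : ι → ℝ) {u v : ℝ}
    (huv : u < v) (hab : ∀ i ∈ S, a i ≤ b i) (hsub : ∀ i ∈ S, Set.Icc (a i) (b i) ⊆ Set.Icc u v) :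
    ∃ s : ℝ, ∑ i ∈ S, (b i - a i) ≤
      (v - u) * ((S.filter fun i => s ∈ Set.Icc (a i) (b i)).card : ℝ) := by
  let f : ℝ → ℝ := fun s => ∑ i ∈ S, (Set.Icc (a i) (b i)).indicator (fun _ => (1 : ℝ)) s
  have hint : ∀ i ∈ S, MeasureTheory.IntegrableOn
      (fun s => (Set.Icc (a i) (b i)).indicator (fun _ => (1 : ℝ)) s) (Set.Icc u v) := fun i _ =>
    (MeasureTheory.integrableOn_const (by simp)).indicator measurableSet_Icc
  obtain ⟨s, -, hs⟩ := MeasureTheory.exists_setAverage_le (μ := MeasureTheory.volume)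
    (s := Set.Icc u v) (f := f) (by simpa using huv) (by simp)
    (MeasureTheory.integrable_finsetSum _ hint)
  refine ⟨s, ?_⟩
  have hf : f s = ((S.filter fun i => s ∈ Set.Icc (a i) (b i)).card : ℝ) := by
    simp [f, Set.indicator_apply, Finset.sum_boole]
  have hsum : ∫ x in Set.Icc u v, f x = ∑ i ∈ S, (b i - a i) := by
    rw [MeasureTheory.integral_finsetSum _ hint]
    refine Finset.sum_congr rfl fun i hi => ?_
    rw [MeasureTheory.setIntegral_indicator measurableSet_Icc, Set.inter_eq_right.2 (hsub i hi)]
    simp [MeasureTheory.Measure.real, hab i hi]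
  rw [MeasureTheory.setAverage_eq, hsum, hf] at hs
  have hvol : MeasureTheory.volume.real (Set.Icc u v) = v - u := by
    simp [MeasureTheory.Measure.real, huv.le]
  rw [hvol, smul_eq_mul, inv_mul_le_iff₀ (sub_pos.2 huv)] at hs
  exact hs

/-- The distance from a point to the line of slope `s` through `pt a b` is at most the vertical
distance. -/
lemma infDist_line_le (a b s x y : ℝ) :
    Metric.infDist (pt x y) {z | ∃ t : ℝ, z = pt a b + t • pt 1 s} ≤
      |y - b - (x - a) * s| := by
  have hmem : pt a b + (x - a) • pt 1 s ∈ {z | ∃ t : ℝ, z = pt a b + t • pt 1 s} := ⟨x - a, rfl⟩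
  refine (Metric.infDist_le_dist_of_mem hmem).trans (le_of_eq ?_)
  rw [EuclideanSpace.dist_eq, Fin.sum_univ_two]
  simp only [pt, WithLp.equiv_symm_apply, PiLp.add_apply, PiLp.smul_apply, Matrix.cons_val_zero,
    Matrix.cons_val_one, smul_eq_mul, Real.dist_eq, sq_abs]
  rw [← Real.sqrt_sq_eq_abs]
  congr 1
  ring

/-- For every `L ≥ 1` there is `c > 0` such that for every `N ≥ 2` and every
permutation `π` of `{1,…,N}` with `|π(n) − π(m)| ≤ L·|n − m|`, some affine line `ℓ ⊆ ℝ²`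
lies within (Euclidean) distance `1` of at least `c·log N` of the points `(n, π(n))`. -/
theorem stmt12 (L : ℝ) (hL : 1 ≤ L) :
    ∃ c : ℝ, 0 < c ∧
      ∀ N : ℕ, 2 ≤ N → ∀ π : ℕ → ℕ,
        Set.BijOn π (Set.Icc 1 N) (Set.Icc 1 N) →
        (∀ n ∈ Set.Icc 1 N, ∀ m ∈ Set.Icc 1 N,
          |(π n : ℝ) - (π m : ℝ)| ≤ L * |(n : ℝ) - (m : ℝ)|) →
        ∃ ℓ : Set (EuclideanSpace ℝ (Fin 2)), IsLine ℓ ∧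
          c * Real.log N ≤
            (((Finset.Icc 1 N).filter
              (fun n : ℕ => Metric.infDist (pt (n : ℝ) (π n : ℝ)) ℓ ≤ 1)).card : ℝ) := by
  refine ⟨1 / (L + 1), by positivity, fun N hN π _ hLip => ?_⟩
  let σ : ℕ → ℝ := fun i => ((π (i + 2) : ℝ) - π 1) / (i + 1)
  have hσ : ∀ i ∈ Finset.range (N - 1), |σ i| ≤ L := by
    intro i hi
    rw [Finset.mem_range] at hi
    have h := hLip (i + 2) ⟨by omega, by omega⟩ 1 ⟨le_rfl, by omega⟩
    have hi0 : (0 : ℝ) < i + 1 := by positivity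
    have hd : ((i + 2 : ℕ) : ℝ) - (1 : ℕ) = i + 1 := by push_cast; ring
    rw [hd, abs_of_pos hi0] at h
    rwa [abs_div, abs_of_pos hi0, div_le_iff₀ hi0]
  have hinv : ∀ i : ℕ, 0 ≤ ((i : ℝ) + 1)⁻¹ ∧ ((i : ℝ) + 1)⁻¹ ≤ 1 := fun i =>
    ⟨by positivity, inv_le_one_of_one_le₀ (by linarith [(Nat.cast_nonneg i : (0 : ℝ) ≤ i)])⟩
  obtain ⟨s, hs⟩ := exists_sum_length_le_mul_card (Finset.range (N - 1))
    (fun i => σ i - ((i : ℝ) + 1)⁻¹) (fun i => σ i + ((i : ℝ) + 1)⁻¹)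
    (u := -(L + 1)) (v := L + 1) (by linarith) (fun i _ => by linarith [(hinv i).1])
    (fun i hi => Set.Icc_subset_Icc (by linarith [(hinv i).2, (abs_le.1 (hσ i hi)).1])
      (by linarith [(hinv i).2, (abs_le.1 (hσ i hi)).2]))
  have hlog : Real.log N ≤ ∑ i ∈ Finset.range (N - 1), ((i : ℝ) + 1)⁻¹ := by
    have h := log_add_one_le_harmonic (N - 1)
    rw [Nat.sub_add_cancel (by omega : 1 ≤ N)] at h
    simpa [harmonic] using h
  have hlen : ∑ i ∈ Finset.range (N - 1), (σ i + ((i : ℝ) + 1)⁻¹ - (σ i - ((i : ℝ) + 1)⁻¹)) =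
      2 * ∑ i ∈ Finset.range (N - 1), ((i : ℝ) + 1)⁻¹ := by
    rw [Finset.mul_sum]
    exact Finset.sum_congr rfl fun i _ => by ring
  rw [hlen] at hs
  refine ⟨{z | ∃ t : ℝ, z = pt (1 : ℕ) (π 1) + t • pt 1 s}, ⟨_, _, fun h => ?_, rfl⟩, ?_⟩
  · simpa [pt] using congrArg (fun z : EuclideanSpace ℝ (Fin 2) => z 0) h
  rw [one_div, inv_mul_le_iff₀ (by linarith)]
  refine le_trans (b := (L + 1) * _) (by linarith) (mul_le_mul_of_nonneg_left
    (Nat.cast_le.2 (Finset.card_le_card_of_injOn (fun i => i + 2) (fun i hi => ?_)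
      fun i _ j _ h => by simpa using h)) (by linarith))
  simp only [Finset.coe_filter, Finset.mem_range, Set.mem_ofPred_eq, Finset.mem_Icc] at hi ⊢
  obtain ⟨hiN, h1, h2⟩ := hi
  refine ⟨⟨by omega, by omega⟩, (infDist_line_le _ _ _ _ _).trans ?_⟩
  have hi0 : (0 : ℝ) < i + 1 := by positivity
  have heq : (π (i + 2) : ℝ) - π 1 - (((i + 2 : ℕ) : ℝ) - (1 : ℕ)) * s = (i + 1) * (σ i - s) := by
    simp only [σ]
    push_cast
    field_simp
    ring
  rw [heq, abs_mul, abs_of_pos hi0, ← le_inv_mul_iff₀ hi0, mul_one]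
  exact abs_le.2 ⟨by linarith, by linarith⟩
end

section
/- For every real A ≥ 1 there exists a constant c > 0 (depending only on A) such that the following holds for every integer N ≥ 2. Let P ⊆ [0,1]² be a set of N points with pairwise distances at least 1/N, such that for every r ∈ [1/N, 1], P can be covered by at most A/r closed balls of radius r. Then there exists an affine line ℓ ⊆ ℝ² such that the number of points p ∈ P with dist(p, ℓ) ≤ 1/N is at least c·log N. -/
open scoped Classical

/-- The vector with `i`-th coordinate `1` and other coordinate `m`. -/
noncomputable def slopeVec (i : Fin 2) (m : ℝ) : EuclideanSpace ℝ (Fin 2) :=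
  WithLp.toLp 2 (fun k => if k = i then 1 else m)

/-- The line through `p` with direction `slopeVec i m`. -/
def slopeLine (p : EuclideanSpace ℝ (Fin 2)) (i : Fin 2) (m : ℝ) :
    Set (EuclideanSpace ℝ (Fin 2)) :=
  {x | ∃ t : ℝ, x = p + t • slopeVec i m}

lemma isLine_slopeLine (p : EuclideanSpace ℝ (Fin 2)) (i : Fin 2) (m : ℝ) :
    IsLine (slopeLine p i m) := by
  refine ⟨p, slopeVec i m, fun h => ?_, rfl⟩
  have := congrArg (fun v : EuclideanSpace ℝ (Fin 2) => v i) h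
  simp [slopeVec] at this

lemma infDist_slopeLine_le {p q : EuclideanSpace ℝ (Fin 2)} {i : Fin 2} {m ε : ℝ} (hε : 0 ≤ ε)
    (h : ∀ k, k ≠ i → |(q k - p k) - (q i - p i) * m| ≤ ε) :
    Metric.infDist q (slopeLine p i m) ≤ ε := by
  refine (Metric.infDist_le_dist_of_mem
    (show p + (q i - p i) • slopeVec i m ∈ slopeLine p i m from ⟨_, rfl⟩)).trans ?_
  rw [EuclideanSpace.dist_eq]
  refine Real.sqrt_le_iff.2 ⟨hε, ?_⟩
  have key : ∀ k, dist (q k) ((p + (q i - p i) • slopeVec i m) k) ^ 2 ≤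
      if k = i then 0 else ε ^ 2 := by
    intro k
    split_ifs with hk
    · subst hk
      simp [slopeVec]
    · have := h k hk
      rw [Real.dist_eq]
      refine pow_le_pow_left₀ (abs_nonneg _) ?_ 2
      simpa [slopeVec, hk, sub_sub] using this
  refine (Finset.sum_le_sum fun k _ => key k).trans ?_
  fin_cases i <;> simp

lemma infDist_slopeLine_self (p : EuclideanSpace ℝ (Fin 2)) (i : Fin 2) (m : ℝ) :
    Metric.infDist p (slopeLine p i m) = 0 :=
  Metric.infDist_zero_of_mem ⟨0, by simp⟩

lemma le_card_int_abs_sub_le {N : ℕ} {a s : ℝ} (ha : |a| ≤ N) (hs : 1 ≤ s) (hs' : s ≤ 2 * N) :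
    s ≤ (((Finset.Icc (-3 * N : ℤ) (3 * N)).filter (fun j : ℤ => |(j : ℝ) - a| ≤ s)).card : ℝ) := by
  have hsub : Finset.Icc ⌈a - s⌉ ⌊a + s⌋ ⊆
      (Finset.Icc (-3 * N : ℤ) (3 * N)).filter (fun j : ℤ => |(j : ℝ) - a| ≤ s) := by
    intro j hj
    rw [Finset.mem_Icc, Int.ceil_le, Int.le_floor] at hj
    rw [abs_le] at ha
    rw [Finset.mem_filter, Finset.mem_Icc, abs_le]
    refine ⟨⟨?_, ?_⟩, by linarith, by linarith⟩
    · have : ((-3 * N : ℤ) : ℝ) ≤ j := by push_cast; linarith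
      exact_mod_cast this
    · have : (j : ℝ) ≤ ((3 * N : ℤ) : ℝ) := by push_cast; linarith
      exact_mod_cast this
  refine le_trans ?_ (Nat.cast_le.2 (Finset.card_le_card hsub))
  rw [Int.card_Icc]
  have h1 := Int.ceil_lt_add_one (a - s)
  have h2 := Int.lt_floor_add_one (a + s)
  have h3 : ((⌊a + s⌋ + 1 - ⌈a - s⌉ : ℤ) : ℝ) ≤ ((⌊a + s⌋ + 1 - ⌈a - s⌉).toNat : ℝ) := by
    exact_mod_cast Int.self_le_toNat _
  push_cast at h3
  linarith

/-- Indices of a `1 / N`-dense family of directions. -/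
noncomputable def slopeIdx (N : ℕ) : Finset (Fin 2 × ℤ) := Finset.univ ×ˢ Finset.Icc (-3 * N : ℤ) (3 * N)

lemma card_slopeIdx (N : ℕ) : (slopeIdx N).card = 2 * (6 * N + 1) := by
  rw [slopeIdx, Finset.card_product, Finset.card_univ, Fintype.card_fin, Int.card_Icc]
  omega

lemma inv_dist_le_card_slopeIdx {N : ℕ} (hN : 0 < N) {p q : EuclideanSpace ℝ (Fin 2)}
    (hle : ∀ k, |q k - p k| ≤ 1) (hpq : 1 / (N : ℝ) ≤ dist p q) :
    1 / dist p q ≤ (((slopeIdx N).filter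
      (fun x => Metric.infDist q (slopeLine p x.1 (x.2 / N)) ≤ 1 / (N : ℝ))).card : ℝ) := by
  have hN' : (0 : ℝ) < N := by exact_mod_cast hN
  obtain ⟨i, hi⟩ := Finite.exists_max (fun k : Fin 2 => |q k - p k|)
  have hd1 : |q i - p i| ≤ dist p q := by
    rw [dist_comm, ← Real.dist_eq]
    exact PiLp.dist_apply_le q p i
  have hd2 : dist p q ≤ 2 * |q i - p i| := by
    rw [dist_comm, EuclideanSpace.dist_eq]
    refine Real.sqrt_le_iff.2 ⟨by positivity, ?_⟩
    rw [Fin.sum_univ_two, Real.dist_eq, Real.dist_eq]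
    have h0 := pow_le_pow_left₀ (abs_nonneg _) (hi 0) 2
    have h1 := pow_le_pow_left₀ (abs_nonneg _) (hi 1) 2
    nlinarith [sq_nonneg (q i - p i), sq_abs (q i - p i)]
  have hNi : 0 < 1 / (N : ℝ) := by positivity
  have hpos : 0 < |q i - p i| := by linarith
  have hne : q i - p i ≠ 0 := abs_pos.1 hpos
  obtain ⟨k, hk⟩ : ∃ k : Fin 2, ∀ l, l ≠ i → l = k := by
    fin_cases i
    · exact ⟨1, by decide⟩
    · exact ⟨0, by decide⟩
  have ha : |N * (q k - p k) / (q i - p i)| ≤ N := by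
    rw [abs_div, abs_mul, Nat.abs_cast, div_le_iff₀ hpos]
    exact mul_le_mul_of_nonneg_left (hi k) hN'.le
  have hs : 1 ≤ 1 / |q i - p i| := by
    rw [le_div_iff₀ hpos]
    simpa using hle i
  have hs' : 1 / |q i - p i| ≤ 2 * N := by
    rw [div_le_iff₀ hpos]
    rw [div_le_iff₀ hN'] at hpq
    nlinarith
  refine (one_div_le_one_div_of_le hpos hd1).trans ((le_card_int_abs_sub_le ha hs hs').trans ?_)
  refine Nat.cast_le.2 (Finset.card_le_card_of_injOn (fun j => (i, j)) ?_ ?_)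
  · intro j hj
    rw [Finset.mem_coe, Finset.mem_filter] at hj
    simp only [Finset.coe_filter, Set.mem_ofPred_eq, slopeIdx, Finset.mem_product,
      Finset.mem_univ, true_and]
    refine ⟨hj.1, infDist_slopeLine_le hNi.le fun l hl => ?_⟩
    rw [hk l hl]
    have heq : (q k - p k) - (q i - p i) * (j / N) =
        -((j - N * (q k - p k) / (q i - p i)) * ((q i - p i) / N)) := by
      field_simp
      ring
    rw [heq, abs_neg, abs_mul, abs_div, Nat.abs_cast]
    calc _ ≤ 1 / |q i - p i| * (|q i - p i| / N) := by gcongr; exact hj.2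
      _ = 1 / N := by field_simp
  · intro a _ b _ hab
    simpa using hab

lemma sum_two_pow_le (K : ℕ) {x : ℝ} (hx : 0 ≤ x) :
    ∑ k ∈ (Finset.range K).filter (fun k => (2 : ℝ) ^ k ≤ x), (2 : ℝ) ^ k ≤ 2 * x := by
  induction K with
  | zero => simpa using hx
  | succ K ih =>
    by_cases h : (2 : ℝ) ^ K ≤ x
    · have h1 : ∑ k ∈ (Finset.range (K + 1)).filter (fun k => (2 : ℝ) ^ k ≤ x), (2 : ℝ) ^ k ≤
          ∑ k ∈ Finset.range (K + 1), (2 : ℝ) ^ k :=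
        Finset.sum_le_sum_of_subset_of_nonneg (Finset.filter_subset _ _)
          (fun _ _ _ => by positivity)
      rw [geom_sum_eq (by norm_num), pow_succ] at h1
      linarith
    · rwa [Finset.range_add_one, Finset.filter_insert, if_neg h]

lemma card_sq_le_mul_card_dist_le {P Z : Finset (EuclideanSpace ℝ (Fin 2))} {r : ℝ}
    (h : (P : Set (EuclideanSpace ℝ (Fin 2))) ⊆ ⋃ z ∈ Z, Metric.closedBall z r) :
    P.card ^ 2 ≤ Z.card * ∑ p ∈ P, (P.filter (fun q => dist p q ≤ 2 * r)).card := by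
  have h' : ∀ p ∈ P, ∃ z ∈ Z, dist p z ≤ r := fun p hp => by
    simpa using h hp
  choose! f hfZ hf using h'
  rw [Finset.card_eq_sum_card_fiberwise (f := f) (t := Z) hfZ]
  refine sq_sum_le_card_mul_sum_sq.trans (Nat.mul_le_mul_left _ ?_)
  have h1 : ∀ z, (P.filter (fun p => f p = z)).card ^ 2 =
      ∑ p ∈ P.filter (fun p => f p = z), (P.filter (fun q => f q = f p)).card := by
    intro z
    rw [sq, ← smul_eq_mul, ← Finset.sum_const]
    refine Finset.sum_congr rfl fun p hp => ?_
    rw [(Finset.mem_filter.1 hp).2]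
  simp_rw [h1]
  rw [Finset.sum_fiberwise_of_maps_to hfZ]
  refine Finset.sum_le_sum fun p hp => Finset.card_le_card fun q hq => ?_
  rw [Finset.mem_filter] at hq ⊢
  refine ⟨hq.1, ?_⟩
  have h2 := hf p hp
  have h3 := hf q hq.1
  rw [hq.2] at h3
  linarith [dist_triangle_right p q (f p)]

lemma sum_two_pow_dist_le_card_slopeIdx {N K : ℕ} (hN : 0 < N) (hK : 2 ^ K ≤ 2 * N)
    {p q : EuclideanSpace ℝ (Fin 2)} (hle : ∀ k, |q k - p k| ≤ 1)
    (hpq : p ≠ q → 1 / (N : ℝ) ≤ dist p q) :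
    ∑ k ∈ (Finset.range K).filter (fun k => dist p q ≤ 2 * (1 / 2 ^ k)), (2 : ℝ) ^ k ≤
      4 * (((slopeIdx N).filter
        (fun x => Metric.infDist q (slopeLine p x.1 (x.2 / N)) ≤ 1 / (N : ℝ))).card : ℝ) := by
  by_cases h : p = q
  · subst h
    rw [Finset.filter_true_of_mem (s := slopeIdx N), card_slopeIdx]
    · have h1 : ∑ k ∈ (Finset.range K).filter (fun k => dist p p ≤ 2 * (1 / 2 ^ k)), (2 : ℝ) ^ k ≤
          ∑ k ∈ Finset.range K, (2 : ℝ) ^ k :=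
        Finset.sum_le_sum_of_subset_of_nonneg (Finset.filter_subset _ _)
          (fun _ _ _ => by positivity)
      rw [geom_sum_eq (by norm_num)] at h1
      have h2 : (2 : ℝ) ^ K ≤ 2 * N := by exact_mod_cast hK
      have h3 : (0 : ℝ) ≤ N := N.cast_nonneg
      push_cast
      linarith
    · intro x _
      rw [infDist_slopeLine_self]
      positivity
  · have hd : 0 < dist p q := dist_pos.2 h
    have h1 := sum_two_pow_le K (x := 2 / dist p q) (by positivity)
    have h2 := inv_dist_le_card_slopeIdx hN hle (hpq h)
    have h3 : ∀ k : ℕ, dist p q ≤ 2 * (1 / 2 ^ k) ↔ (2 : ℝ) ^ k ≤ 2 / dist p q := by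
      intro k
      rw [le_div_iff₀ hd, mul_one_div, le_div_iff₀ (by positivity), mul_comm]
    simp_rw [h3]
    calc _ ≤ 2 * (2 / dist p q) := h1
      _ = 4 * (1 / dist p q) := by ring
      _ ≤ _ := by gcongr

lemma sq_div_le_sum_two_pow_dist {A : ℝ} (hA : 0 < A) {k : ℕ}
    {P Z : Finset (EuclideanSpace ℝ (Fin 2))} (hZ : (Z.card : ℝ) ≤ A / (1 / 2 ^ k))
    (hPZ : (P : Set (EuclideanSpace ℝ (Fin 2))) ⊆ ⋃ z ∈ Z, Metric.closedBall z (1 / 2 ^ k)) :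
    (P.card : ℝ) ^ 2 / A ≤
      ∑ p ∈ P, ∑ _q ∈ P.filter (fun q => dist p q ≤ 2 * (1 / 2 ^ k)), (2 : ℝ) ^ k := by
  have h : (P.card : ℝ) ^ 2 ≤
      Z.card * ∑ p ∈ P, ((P.filter (fun q => dist p q ≤ 2 * (1 / 2 ^ k))).card : ℝ) := by
    exact_mod_cast card_sq_le_mul_card_dist_le hPZ
  simp_rw [Finset.sum_const, nsmul_eq_mul]
  rw [← Finset.sum_mul, div_le_iff₀ hA]
  calc _ ≤ _ := h
    _ ≤ A / (1 / 2 ^ k) *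
        ∑ p ∈ P, ((P.filter (fun q => dist p q ≤ 2 * (1 / 2 ^ k))).card : ℝ) := by gcongr
    _ = _ := by field_simp

lemma sum_card_slopeIdx_lt {N : ℕ} (hN : 2 ≤ N) {P : Finset (EuclideanSpace ℝ (Fin 2))}
    {p : EuclideanSpace ℝ (Fin 2)} {B : ℝ}
    (h : ∀ (i : Fin 2) (m : ℝ), ((P.filter
      (fun q => Metric.infDist q (slopeLine p i m) ≤ 1 / (N : ℝ))).card : ℝ) < B) :
    ∑ q ∈ P, (((slopeIdx N).filter
      (fun x => Metric.infDist q (slopeLine p x.1 (x.2 / N)) ≤ 1 / (N : ℝ))).card : ℝ) <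
      14 * N * B := by
  have h1 : ∑ q ∈ P, (((slopeIdx N).filter
      (fun x => Metric.infDist q (slopeLine p x.1 (x.2 / N)) ≤ 1 / (N : ℝ))).card : ℝ) =
      ∑ x ∈ slopeIdx N, ((P.filter
        (fun q => Metric.infDist q (slopeLine p x.1 (x.2 / N)) ≤ 1 / (N : ℝ))).card : ℝ) := by
    exact_mod_cast Finset.sum_card_bipartiteAbove_eq_sum_card_bipartiteBelow
      (fun (q : EuclideanSpace ℝ (Fin 2)) (x : Fin 2 × ℤ) =>
        Metric.infDist q (slopeLine p x.1 (x.2 / N)) ≤ 1 / (N : ℝ))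
  have hne : (slopeIdx N).Nonempty := Finset.card_pos.1 (by rw [card_slopeIdx]; omega)
  have hB : 0 ≤ B := (Nat.cast_nonneg _).trans (h 0 0).le
  have hN' : (2 : ℝ) ≤ N := by exact_mod_cast hN
  rw [h1]
  refine (Finset.sum_lt_sum_of_nonempty hne fun x _ => h _ _).trans_le ?_
  rw [Finset.sum_const, card_slopeIdx, nsmul_eq_mul]
  refine mul_le_mul_of_nonneg_right ?_ hB
  push_cast
  linarith

/-- For every `A ≥ 1` there is `c > 0` such that for every `N ≥ 2` and
every set `P` of `N` points of `[0,1]²` with pairwise distances at least `1/N` which,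
for every `r ∈ [1/N, 1]`, can be covered by at most `A/r` closed balls of radius `r`,
there is an affine line `ℓ ⊆ ℝ²` within distance `1/N` of at least `c·log N` points
of `P`. -/
theorem stmt19 (A : ℝ) (hA : 1 ≤ A) :
    ∃ c : ℝ, 0 < c ∧
      ∀ N : ℕ, 2 ≤ N →
        ∀ P : Finset (EuclideanSpace ℝ (Fin 2)),
          P.card = N →
          (∀ p ∈ P, ∀ i : Fin 2, p i ∈ Set.Icc (0 : ℝ) 1) →
          (∀ p ∈ P, ∀ q ∈ P, p ≠ q → 1 / (N : ℝ) ≤ dist p q) →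
          (∀ r : ℝ, 1 / N ≤ r → r ≤ 1 →
            ∃ Z : Finset (EuclideanSpace ℝ (Fin 2)), (Z.card : ℝ) ≤ A / r ∧
              ↑P ⊆ ⋃ z ∈ Z, Metric.closedBall z r) →
          ∃ ℓ : Set (EuclideanSpace ℝ (Fin 2)), IsLine ℓ ∧
            c * Real.log N ≤
              ((P.filter (fun p => Metric.infDist p ℓ ≤ 1 / (N : ℝ))).card : ℝ) := by
  refine ⟨1 / (56 * A), by positivity, fun N hN P hcard hbox hsep hcov => ?_⟩
  by_contra! hcon
  have hN0 : 0 < N := by omega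
  have hN' : (2 : ℝ) ≤ N := by exact_mod_cast hN
  set K := Nat.log 2 N + 1 with hKdef
  have hK : 2 ^ K ≤ 2 * N := by
    rw [hKdef, pow_succ, mul_comm]
    exact Nat.mul_le_mul_left _ (Nat.pow_log_le_self 2 hN0.ne')
  have hlog : Real.log N ≤ K := by
    have h1 : (N : ℝ) ≤ 2 ^ K := by exact_mod_cast (Nat.lt_pow_succ_log_self one_lt_two N).le
    calc Real.log N ≤ Real.log (2 ^ K) := Real.log_le_log (by positivity) h1
      _ = K * Real.log 2 := Real.log_pow _ _
      _ ≤ K * 1 := by gcongr; linarith [Real.log_two_lt_d9]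
      _ = K := mul_one _
  have hle : ∀ p ∈ P, ∀ q ∈ P, ∀ k, |q k - p k| ≤ 1 := fun p hp q hq k => by
    have h1 := hbox p hp k
    have h2 := hbox q hq k
    rw [Set.mem_Icc] at h1 h2
    rw [abs_le]
    constructor <;> linarith
  have hpairs : ∀ k ∈ Finset.range K, (N : ℝ) ^ 2 / A ≤
      ∑ p ∈ P, ∑ _q ∈ P.filter (fun q => dist p q ≤ 2 * (1 / 2 ^ k)), (2 : ℝ) ^ k := by
    intro k hk
    have hkN : (2 : ℝ) ^ k ≤ N := by
      have : 2 ^ k ≤ N := Nat.pow_le_of_le_log hN0.ne' (by rw [Finset.mem_range] at hk; omega)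
      exact_mod_cast this
    have hk1 : (1 : ℝ) ≤ 2 ^ k := one_le_pow₀ one_le_two
    obtain ⟨Z, hZ, hPZ⟩ := hcov (1 / 2 ^ k) (one_div_le_one_div_of_le (by positivity) hkN)
      (by rw [div_le_one (by positivity)]; exact hk1)
    rw [← hcard]
    exact sq_div_le_sum_two_pow_dist (by positivity) hZ hPZ
  have hlower : K * ((N : ℝ) ^ 2 / A) ≤ ∑ p ∈ P, ∑ q ∈ P, 4 * (((slopeIdx N).filter
      (fun x => Metric.infDist q (slopeLine p x.1 (x.2 / N)) ≤ 1 / (N : ℝ))).card : ℝ) := by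
    have h1 := Finset.sum_le_sum hpairs
    rw [Finset.sum_const, Finset.card_range, nsmul_eq_mul, Finset.sum_comm] at h1
    refine h1.trans (Finset.sum_le_sum fun p hp => ?_)
    simp_rw [Finset.sum_filter]
    rw [Finset.sum_comm]
    simp_rw [← Finset.sum_filter]
    exact Finset.sum_le_sum fun q hq =>
      sum_two_pow_dist_le_card_slopeIdx hN0 hK (hle p hp q hq) (hsep p hp q hq)
  have hupper : ∀ p ∈ P, ∑ q ∈ P, 4 * (((slopeIdx N).filter
      (fun x => Metric.infDist q (slopeLine p x.1 (x.2 / N)) ≤ 1 / (N : ℝ))).card : ℝ) <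
      4 * (14 * N * (1 / (56 * A) * K)) := by
    intro p _
    rw [← Finset.mul_sum]
    refine mul_lt_mul_of_pos_left (sum_card_slopeIdx_lt hN fun i m => ?_) (by norm_num)
    exact (hcon _ (isLine_slopeLine p i m)).trans_le
      (mul_le_mul_of_nonneg_left hlog (by positivity))
  have hPne : P.Nonempty := Finset.card_pos.1 (by omega)
  have h := hlower.trans_lt (Finset.sum_lt_sum_of_nonempty hPne hupper)
  rw [Finset.sum_const, hcard, nsmul_eq_mul] at h
  refine h.ne ?_
  field_simp
  ring
end
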